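/- arXiv:1909.06232 — 4 statements merged into one kernel-verified Lean document; each statement's English description precedes it below -/
import Mathlib

section
/- Let H be a complex Hilbert space and let 𝔄 ⊆ B(H) be a closed unital *-subalgebra (a C*-subalgebra containing the identity operator) of the algebra B(H) of bounded operators on H. Let Φ ∈ H be a unit vector and suppose that the orthogonal projection E onto the one-dimensional subspace spanned by Φ belongs to 𝔄. Then the vector state ω_Φ on 𝔄, defined by ω_Φ(A) = ⟨Φ, AΦ⟩, is a pure state of 𝔄. -/
open scoped ComplexOrder ComplexInnerProductSpace

variable {H : Type*} [NormedAddCommGroup H] [InnerProductSpace ℂ H] [CompleteSpace H]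

/-- A state on a unital *-algebra of operators: a linear functional that is
positive (`ω(a*a) ≥ 0`) and normalised (`ω(1) = 1`). -/
def IsState {A : Type*} [Ring A] [Algebra ℂ A] [Star A] (ω : A → ℂ) : Prop :=
  (∀ x y : A, ω (x + y) = ω x + ω y) ∧
  (∀ (c : ℂ) (x : A), ω (c • x) = c * ω x) ∧
  (∀ x : A, 0 ≤ ω (star x * x)) ∧
  ω 1 = 1

theorem Complex.eq_zero_of_forall_real_mul_add_nonneg {z K : ℂ}
    (h : ∀ t : ℝ, 0 ≤ (t : ℂ) * z + K) : z = 0 := by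
  simp only [Complex.le_def, Complex.zero_re, Complex.zero_im, Complex.add_re, Complex.add_im,
    Complex.re_ofReal_mul, Complex.im_ofReal_mul] at h
  apply Complex.ext
  · by_contra hz
    have hz' : z.re ≠ 0 := hz
    have ht := (h (-(K.re + 1) / z.re)).1
    rw [div_mul_cancel₀ _ hz'] at ht
    linarith
  · have h0 := (h 0).2
    have h1 := (h 1).2
    simp only [Complex.zero_im]
    linarith

namespace IsState

variable {A : Type*} [Ring A] [Algebra ℂ A] [StarRing A] {ω : A → ℂ}

theorem apply_sub (h : IsState ω) (x y : A) : ω (x - y) = ω x - ω y := by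
  have := h.1 (x - y) y
  rw [sub_add_cancel] at this
  rw [this, add_sub_cancel_right]

theorem nonneg_apply_smul_add [StarModule ℂ A] (h : IsState ω) (c : ℂ) (x y : A) :
    0 ≤ star c * c * ω (star x * x) + star c * ω (star x * y) + c * ω (star y * x)
      + ω (star y * y) := by
  have := h.2.2.1 (c • x + y)
  simp only [star_add, star_smul, add_mul, mul_add, smul_mul_assoc, mul_smul_comm, h.1,
    h.2.1] at this
  convert this using 1
  ring

/-- The case of the Cauchy-Schwarz inequality in which one factor vanishes. -/
theorem apply_star_mul_eq_zero [StarModule ℂ A] (h : IsState ω) {x : A}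
    (hx : ω (star x * x) = 0) (y : A) :
    ω (star x * y) = 0 ∧ ω (star y * x) = 0 := by
  have hadd : ω (star x * y) + ω (star y * x) = 0 := by
    refine Complex.eq_zero_of_forall_real_mul_add_nonneg (K := ω (star y * y)) fun t => ?_
    have := h.nonneg_apply_smul_add t x y
    simp only [hx, Complex.star_def, Complex.conj_ofReal] at this
    convert this using 1
    ring
  have hsub : Complex.I * (ω (star y * x) - ω (star x * y)) = 0 := by
    refine Complex.eq_zero_of_forall_real_mul_add_nonneg (K := ω (star y * y)) fun t => ?_
    have := h.nonneg_apply_smul_add (t * Complex.I) x y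
    simp only [hx, Complex.star_def, map_mul, Complex.conj_ofReal, Complex.conj_I] at this
    convert this using 1
    ring
  have heq := (mul_eq_zero.mp hsub).resolve_left Complex.I_ne_zero
  constructor
  · linear_combination (hadd - heq) / 2
  · linear_combination (hadd + heq) / 2

/-- A state that takes the value `1` on a projection is determined by the corner it cuts out. -/
theorem apply_eq_apply_mul_mul [StarModule ℂ A] (h : IsState ω) {e : A}
    (he : IsStarProjection e) (h1 : ω e = 1) (a : A) : ω a = ω (e * a * e) := by
  have hp := he.one_sub
  have hp0 : ω (star (1 - e) * (1 - e)) = 0 := by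
    rw [hp.isSelfAdjoint.star_eq, hp.isIdempotentElem.eq, h.apply_sub, h.2.2.2, h1, sub_self]
  have hl := (h.apply_star_mul_eq_zero hp0 a).1
  have hr := (h.apply_star_mul_eq_zero hp0 (star (e * a))).2
  rw [hp.isSelfAdjoint.star_eq, sub_mul, one_mul, h.apply_sub, sub_eq_zero] at hl
  rw [star_star, mul_sub, mul_one, h.apply_sub, sub_eq_zero] at hr
  exact hl.trans hr

theorem apply_nonneg (h : IsState ω) {e : A} (he : IsStarProjection e) : 0 ≤ ω e := by
  simpa only [he.isSelfAdjoint.star_eq, he.isIdempotentElem.eq] using h.2.2.1 e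

theorem apply_le_one (h : IsState ω) {e : A} (he : IsStarProjection e) : ω e ≤ 1 := by
  simpa only [h.apply_sub, h.2.2.2, sub_nonneg] using h.apply_nonneg he.one_sub

end IsState

/-- If a proper convex combination of two numbers at most `1` equals `1`, both equal `1`. -/
theorem Complex.eq_one_of_convex_combination_eq_one {l : ℝ} (hl : l ∈ Set.Ioo (0 : ℝ) 1)
    {z w : ℂ} (hz : z ≤ 1) (hw : w ≤ 1) (h : (l : ℂ) * z + (1 - (l : ℂ)) * w = 1) :
    z = 1 ∧ w = 1 := by
  obtain ⟨h0, h1⟩ := hl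
  have hl0 : (0 : ℂ) < l := by exact_mod_cast h0
  have hl1 : (0 : ℂ) < 1 - (l : ℂ) := by
    rw [sub_pos]
    exact_mod_cast h1
  have hz' := mul_nonneg hl0.le (sub_nonneg.mpr hz)
  have hw' := mul_nonneg hl1.le (sub_nonneg.mpr hw)
  have hsum : (l : ℂ) * (1 - z) + (1 - (l : ℂ)) * (1 - w) = 0 := by
    linear_combination -h
  obtain ⟨hz0, hw0⟩ := (add_eq_zero_iff_of_nonneg hz' hw').mp hsum
  exact ⟨(sub_eq_zero.mp ((mul_eq_zero.mp hz0).resolve_left hl0.ne')).symm,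
    (sub_eq_zero.mp ((mul_eq_zero.mp hw0).resolve_left hl1.ne')).symm⟩

/-- If `𝔄 ⊆ B(H)` is a closed unital *-subalgebra, `Φ` is a unit vector, and
the orthogonal projection `E` onto `ℂΦ` belongs to `𝔄`, then the vector state
`ω_Φ(A) = ⟨Φ, AΦ⟩` is a pure state of `𝔄`: any decomposition of it as a convex
combination `λω₁ + (1−λ)ω₂` of states with `λ ∈ (0,1)` forces `ω₁ = ω₂`. -/
theorem vector_state_pure_of_proj_mem
    (𝔄 : StarSubalgebra ℂ (H →L[ℂ] H)) (hclosed : IsClosed (𝔄 : Set (H →L[ℂ] H)))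
    (Φ : H) (hΦ : ‖Φ‖ = 1)
    (E : H →L[ℂ] H) (hE : ∀ ψ : H, E ψ = ⟪Φ, ψ⟫ • Φ) (hE𝔄 : E ∈ 𝔄)
    (ω₁ ω₂ : 𝔄 → ℂ) (h1 : IsState ω₁) (h2 : IsState ω₂)
    (l : ℝ) (hl : l ∈ Set.Ioo (0 : ℝ) 1)
    (hmix : ∀ A : 𝔄, ⟪Φ, (A : H →L[ℂ] H) Φ⟫ = (l : ℂ) * ω₁ A + (1 - (l : ℂ)) * ω₂ A) :
    ω₁ = ω₂ := by
  set e : 𝔄 := ⟨E, hE𝔄⟩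
  have he : IsStarProjection e := by
    constructor
    · apply Subtype.ext
      ext ψ
      simp [e, hE, hΦ]
    · apply Subtype.ext
      change star E = E
      rw [ContinuousLinearMap.star_eq_adjoint, eq_comm, ContinuousLinearMap.eq_adjoint_iff]
      intro x y
      simp only [hE, inner_smul_left, inner_smul_right, inner_conj_symm]
      ring
  have hcorner (a : 𝔄) : e * a * e = ⟪Φ, (a : H →L[ℂ] H) Φ⟫ • e := by
    apply Subtype.ext
    ext ψ
    simp [e, hE, smul_smul, mul_comm]
  have hmix_e := hmix e
  have he_apply : ⟪Φ, (e : H →L[ℂ] H) Φ⟫ = 1 := by simp [e, hE, hΦ]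
  rw [he_apply] at hmix_e
  obtain ⟨h1e, h2e⟩ := Complex.eq_one_of_convex_combination_eq_one hl
    (h1.apply_le_one he) (h2.apply_le_one he) hmix_e.symm
  funext a
  rw [h1.apply_eq_apply_mul_mul he h1e, h2.apply_eq_apply_mul_mul he h2e, hcorner,
    h1.2.1, h2.2.1, h1e, h2e]
end

section
/- Let ψ : ℝ → ℂ be a Schwartz function with ‖ψ‖_{L²(ℝ)} = 1, let (x₀, ξ₀) ∈ ℝ², and for ħ > 0 define the wave packet ψ^ħ(x) = ħ^{−1/4} ψ((x − x₀)/√ħ) e^{i x ξ₀ / ħ}. Let a : ℝ² → ℂ be a smooth compactly supported function and define its Weyl quantisation op_ħ(a) on ψ^ħ by (op_ħ(a) ψ^ħ)(x) = (1/(2πħ)) ∫_ℝ ∫_ℝ e^{(i/ħ) ξ(x−y)} a((x+y)/2, ξ) ψ^ħ(y) dy dξ. Then lim_{ħ → 0⁺} ⟨ψ^ħ, op_ħ(a) ψ^ħ⟩_{L²(ℝ)} = a(x₀, ξ₀). -/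
open MeasureTheory

/-- The semiclassical wave packet
`ψ^hb(x) = hb^{-1/4} ψ((x − x₀)/√hb) e^{i x ξ₀ / hb}` built from a Schwartz
function `ψ` and a phase-space point `(x₀, ξ₀)`. -/
noncomputable def wavePacket (ψ : SchwartzMap ℝ ℂ) (x₀ ξ₀ : ℝ) (hb : ℝ) (x : ℝ) : ℂ :=
  ((hb ^ (-(1 / 4 : ℝ)) : ℝ) : ℂ) * ψ ((x - x₀) / Real.sqrt hb) *
    Complex.exp (Complex.I * x * ξ₀ / hb)

/-- The `x`-derivative `∂ₓ a` of a symbol on phase space. -/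
noncomputable def symbolDeriv (a : ℝ × ℝ → ℂ) (p : ℝ × ℝ) : ℂ := fderiv ℝ a p (1, 0)

theorem ContDiff.symbolDeriv {a : ℝ × ℝ → ℂ} (ha : ContDiff ℝ (⊤ : ℕ∞) a) :
    ContDiff ℝ (⊤ : ℕ∞) (symbolDeriv a) :=
  (ha.fderiv_right (by simp)).clm_apply contDiff_const

theorem HasCompactSupport.symbolDeriv {a : ℝ × ℝ → ℂ} (ha : HasCompactSupport a) :
    HasCompactSupport (symbolDeriv a) :=
  ha.fderiv_apply ℝ (1, 0)

theorem hasDerivAt_symbol_midpoint {a : ℝ × ℝ → ℂ} (ha : ContDiff ℝ (⊤ : ℕ∞) a)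
    (x₀ s u c v : ℝ) :
    HasDerivAt (fun v : ℝ => a (x₀ + s * ((u + v) / 2), c))
      ((s / 2 : ℝ) * symbolDeriv a (x₀ + s * ((u + v) / 2), c)) v := by
  have h1 : HasDerivAt (fun v : ℝ => (x₀ + s * ((u + v) / 2), c)) (s / 2, 0) v := by
    refine HasDerivAt.prodMk ?_ (hasDerivAt_const v c)
    exact (((((hasDerivAt_id' v).const_add u).div_const 2).const_mul s).const_add x₀).congr_deriv
      (by ring)
  have h2 := (ha.differentiable (by simp) (x₀ + s * ((u + v) / 2), c)).hasFDerivAt.comp_hasDerivAt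
    v h1
  refine h2.congr_deriv ?_
  have : ((s / 2, 0) : ℝ × ℝ) = (s / 2) • (1, 0) := by simp
  rw [this, map_smul, Complex.real_smul, symbolDeriv]

theorem norm_cexp_I_mul_mul_sub (η u v : ℝ) :
    ‖Complex.exp (Complex.I * η * (u - v))‖ = 1 := by
  have : Complex.I * η * (u - v) = ((η * (u - v) : ℝ) : ℂ) * Complex.I := by push_cast; ring
  rw [this, Complex.norm_exp_ofReal_mul_I]

theorem MeasureTheory.Integrable.cexp_mul {g : ℝ → ℂ} (hg : Integrable g) (η u : ℝ) :
    Integrable fun v : ℝ => Complex.exp (Complex.I * η * (u - v)) * g v :=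
  hg.bdd_mul (c := 1) (by fun_prop)
    (.of_forall fun v => (norm_cexp_I_mul_mul_sub η u v).le)

theorem integral_cexp_mul_deriv {g g' : ℝ → ℂ} (hd : ∀ v, HasDerivAt g (g' v) v)
    (hg : Integrable g) (hg' : Integrable g') (η u : ℝ) :
    ∫ v : ℝ, Complex.exp (Complex.I * η * (u - v)) * g' v =
      Complex.I * η * ∫ v : ℝ, Complex.exp (Complex.I * η * (u - v)) * g v := by
  have he : ∀ v : ℝ, HasDerivAt (fun v : ℝ => Complex.exp (Complex.I * η * (u - v)))
      (-(Complex.I * η) * Complex.exp (Complex.I * η * (u - v))) v := by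
    intro v
    refine ((((hasDerivAt_id' v).ofReal_comp).const_sub (u : ℂ)).const_mul
      (Complex.I * η)).cexp.congr_deriv ?_
    push_cast; ring
  have h := integral_mul_deriv_eq_deriv_mul_of_integrable (fun v _ => he v) (fun v _ => hd v)
    (hg'.cexp_mul η u) (by
      have := (hg.cexp_mul η u).const_mul (-(Complex.I * η))
      refine this.congr (.of_forall fun v => ?_)
      simp only [Pi.mul_apply]; ring) (hg.cexp_mul η u)
  rw [h, ← integral_neg, ← integral_const_mul]
  exact integral_congr_ae (.of_forall fun v => by simp only; ring)

theorem norm_integral_cexp_mul_le {g g₁ g₂ : ℝ → ℂ} (hd : ∀ v, HasDerivAt g (g₁ v) v)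
    (hd₁ : ∀ v, HasDerivAt g₁ (g₂ v) v) (hg : Integrable g) (hg₁ : Integrable g₁)
    (hg₂ : Integrable g₂) (η u : ℝ) :
    ‖∫ v : ℝ, Complex.exp (Complex.I * η * (u - v)) * g v‖ ≤
      ((∫ v, ‖g v‖) + ∫ v, ‖g₂ v‖) * (1 + η ^ 2)⁻¹ := by
  have key : ∀ f : ℝ → ℂ, ‖∫ v : ℝ, Complex.exp (Complex.I * η * (u - v)) * f v‖ ≤
      ∫ v, ‖f v‖ := fun f => (norm_integral_le_integral_norm _).trans_eq <| by
    simp [norm_cexp_I_mul_mul_sub]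
  have h2 := integral_cexp_mul_deriv hd₁ hg₁ hg₂ η u
  rw [integral_cexp_mul_deriv hd hg hg₁] at h2
  have h3 : ((1 + η ^ 2 : ℝ) : ℂ) * ∫ v : ℝ, Complex.exp (Complex.I * η * (u - v)) * g v =
      (∫ v : ℝ, Complex.exp (Complex.I * η * (u - v)) * g v) -
        ∫ v : ℝ, Complex.exp (Complex.I * η * (u - v)) * g₂ v := by
    rw [h2]; push_cast; linear_combination
      (η ^ 2 * ∫ v : ℝ, Complex.exp (Complex.I * η * (u - v)) * g v) * Complex.I_sq
  have hpos : 0 < 1 + η ^ 2 := by positivity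
  have h4 := congrArg norm h3
  rw [norm_mul, Complex.norm_real, Real.norm_of_nonneg hpos.le] at h4
  rw [← div_eq_mul_inv, le_div_iff₀ hpos, mul_comm, h4]
  exact (norm_sub_le _ _).trans (add_le_add (key g) (key g₂))

theorem SchwartzMap.norm_integral_cexp_mul_mul_le (ψ : SchwartzMap ℝ ℂ) (M : ℝ) :
    ∃ C : ℝ, 0 ≤ C ∧ ∀ b b₁ b₂ : ℝ → ℂ, (∀ v, HasDerivAt b (b₁ v) v) →
      (∀ v, HasDerivAt b₁ (b₂ v) v) → Continuous b₂ → (∀ v, ‖b v‖ ≤ M) → (∀ v, ‖b₁ v‖ ≤ M) →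
      (∀ v, ‖b₂ v‖ ≤ M) → ∀ η u : ℝ,
      ‖∫ v : ℝ, Complex.exp (Complex.I * η * (u - v)) * (b v * ψ v)‖ ≤ C * (1 + η ^ 2)⁻¹ := by
  set ψ₁ := SchwartzMap.derivCLM ℂ ℂ ψ with hψ₁
  set ψ₂ := SchwartzMap.derivCLM ℂ ℂ ψ₁ with hψ₂
  have hd : ∀ v, HasDerivAt ψ (ψ₁ v) v := fun v => by
    rw [hψ₁, SchwartzMap.derivCLM_apply]; exact ψ.hasDerivAt v
  have hd₁ : ∀ v, HasDerivAt ψ₁ (ψ₂ v) v := fun v => by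
    rw [hψ₂, SchwartzMap.derivCLM_apply]; exact ψ₁.hasDerivAt v
  have i0 : Integrable fun v => ‖ψ v‖ := ψ.integrable.norm
  have i1 : Integrable fun v => ‖ψ₁ v‖ := ψ₁.integrable.norm
  have i2 : Integrable fun v => ‖ψ₂ v‖ := ψ₂.integrable.norm
  refine ⟨|M| * (∫ v, ‖ψ v‖) + |M| * ∫ v, (‖ψ v‖ + 2 * ‖ψ₁ v‖ + ‖ψ₂ v‖), by positivity, ?_⟩
  intro b b₁ b₂ hb hb₁ cb₂ h0 h1 h2 η u
  have cb : Continuous b := continuous_iff_continuousAt.2 fun v => (hb v).continuousAt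
  have cb₁ : Continuous b₁ := continuous_iff_continuousAt.2 fun v => (hb₁ v).continuousAt
  have int : ∀ (f : ℝ → ℂ) (φ : SchwartzMap ℝ ℂ), Continuous f → (∀ v, ‖f v‖ ≤ M) →
      Integrable fun v => f v * φ v := fun f φ hf h =>
    φ.integrable.bdd_mul hf.aestronglyMeasurable (.of_forall h)
  have hM : ∀ {x : ℝ}, x ≤ M → x ≤ |M| := fun h => h.trans (le_abs_self M)
  have d1 : ∀ v, HasDerivAt (fun v => b v * ψ v) (b₁ v * ψ v + b v * ψ₁ v) v := fun v =>
    (hb v).mul (hd v)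
  have d2 : ∀ v, HasDerivAt (fun v => b₁ v * ψ v + b v * ψ₁ v)
      ((b₂ v * ψ v + b₁ v * ψ₁ v) + (b₁ v * ψ₁ v + b v * ψ₂ v)) v := fun v =>
    ((hb₁ v).mul (hd v)).add ((hb v).mul (hd₁ v))
  have ig₂ := ((int b₂ ψ cb₂ h2).add (int b₁ ψ₁ cb₁ h1)).add
    ((int b₁ ψ₁ cb₁ h1).add (int b ψ₂ cb h0))
  refine (norm_integral_cexp_mul_le d1 d2 (int b ψ cb h0)
    ((int b₁ ψ cb₁ h1).add (int b ψ₁ cb h0)) ig₂ η u).trans ?_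
  refine mul_le_mul_of_nonneg_right (add_le_add ?_ ?_) (by positivity)
  · rw [← integral_const_mul]
    refine integral_mono (int b ψ cb h0).norm (i0.const_mul _) fun v => ?_
    simp only [norm_mul]
    exact mul_le_mul_of_nonneg_right (hM (h0 v)) (norm_nonneg _)
  · rw [← integral_const_mul]
    refine integral_mono ig₂.norm (((i0.add (i1.const_mul 2)).add i2).const_mul _) fun v => ?_
    have e1 := mul_le_mul_of_nonneg_right (hM (h2 v)) (norm_nonneg (ψ v))
    have e2 := mul_le_mul_of_nonneg_right (hM (h1 v)) (norm_nonneg (ψ₁ v))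
    have e3 := mul_le_mul_of_nonneg_right (hM (h0 v)) (norm_nonneg (ψ₂ v))
    calc ‖b₂ v * ψ v + b₁ v * ψ₁ v + (b₁ v * ψ₁ v + b v * ψ₂ v)‖
        ≤ ‖b₂ v * ψ v‖ + ‖b₁ v * ψ₁ v‖ + (‖b₁ v * ψ₁ v‖ + ‖b v * ψ₂ v‖) :=
          (norm_add_le _ _).trans (add_le_add (norm_add_le _ _) (norm_add_le _ _))
      _ ≤ |M| * (‖ψ v‖ + 2 * ‖ψ₁ v‖ + ‖ψ₂ v‖) := by
          simp only [norm_mul]; linarith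

theorem exists_bound_integral_scaled_symbol (ψ : SchwartzMap ℝ ℂ) (x₀ ξ₀ : ℝ) {a : ℝ × ℝ → ℂ}
    (ha : ContDiff ℝ (⊤ : ℕ∞) a) (hsupp : HasCompactSupport a) :
    ∃ C : ℝ, 0 ≤ C ∧ ∀ s : ℝ, 0 ≤ s → s ≤ 1 → ∀ u η : ℝ,
      ‖∫ v : ℝ, Complex.exp (Complex.I * η * (u - v)) *
        (a (x₀ + s * ((u + v) / 2), ξ₀ + s * η) * ψ v)‖ ≤ C * (1 + η ^ 2)⁻¹ := by
  obtain ⟨M₀, h0⟩ := hsupp.exists_bound_of_continuous ha.continuous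
  obtain ⟨M₁, h1⟩ := hsupp.symbolDeriv.exists_bound_of_continuous ha.symbolDeriv.continuous
  obtain ⟨M₂, h2⟩ := hsupp.symbolDeriv.symbolDeriv.exists_bound_of_continuous
    ha.symbolDeriv.symbolDeriv.continuous
  obtain ⟨C, hC, h⟩ := ψ.norm_integral_cexp_mul_mul_le (max M₀ (max M₁ M₂))
  refine ⟨C, hC, fun s hs hs1 u η => ?_⟩
  have hn : ‖((s / 2 : ℝ) : ℂ)‖ ≤ 1 := by
    rw [Complex.norm_real, Real.norm_of_nonneg (by positivity)]; linarith
  have red : ∀ {z : ℂ} {M : ℝ}, ‖z‖ ≤ M → ‖((s / 2 : ℝ) : ℂ) * z‖ ≤ M := fun {z M} hz => by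
    rw [norm_mul]; exact (mul_le_of_le_one_left (norm_nonneg _) hn).trans hz
  refine h _ _ _ (fun v => hasDerivAt_symbol_midpoint ha x₀ s u (ξ₀ + s * η) v)
    (fun v => (hasDerivAt_symbol_midpoint ha.symbolDeriv x₀ s u (ξ₀ + s * η) v).const_mul _)
    ?_ (fun v => (h0 _).trans (by simp)) (fun v => red ((h1 _).trans (by simp)))
    (fun v => red (red ((h2 _).trans (by simp)))) η u
  have := ha.symbolDeriv.symbolDeriv.continuous
  fun_prop

open FourierTransform in
theorem SchwartzMap.integral_integral_cexp_mul (ψ : SchwartzMap ℝ ℂ) (u : ℝ) :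
    ∫ η : ℝ, ∫ v : ℝ, Complex.exp (Complex.I * η * (u - v)) * ψ v = 2 * Real.pi * ψ u := by
  have h : (𝓕⁻ (𝓕 ψ)) u = ψ u := by rw [fourierInv_fourier_eq ψ]
  rw [SchwartzMap.fourierInv_coe, Real.fourierInv_eq', SchwartzMap.fourier_coe] at h
  have h2 := Measure.integral_comp_mul_left
    (fun η : ℝ => ∫ v : ℝ, Complex.exp (Complex.I * η * (u - v)) * ψ v) (2 * Real.pi)
  have h3 : ∀ w : ℝ, ∫ v : ℝ, Complex.exp (Complex.I * (2 * Real.pi * w : ℝ) * (u - v)) * ψ v =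
      Complex.exp (↑(2 * Real.pi * inner ℝ w u) * Complex.I) • 𝓕 (⇑ψ) w := by
    intro w
    rw [Real.fourier_eq', smul_eq_mul, ← integral_const_mul]
    refine integral_congr_ae (.of_forall fun v => ?_)
    simp only [smul_eq_mul]
    rw [← mul_assoc, ← Complex.exp_add]
    congr 2
    simp; ring
  simp only [h3] at h2
  rw [h, abs_of_pos (by positivity), Complex.real_smul] at h2
  rw [h2, ← mul_assoc]
  push_cast
  rw [mul_inv_cancel₀ (by simp [Real.pi_ne_zero]), one_mul]

theorem integral_eq_mul_integral_comp_add_mul (f : ℝ → ℂ) (c : ℝ) {s : ℝ} (hs : 0 < s) :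
    ∫ x, f x = s * ∫ u, f (c + s * u) := by
  rw [Measure.integral_comp_mul_left (fun y => f (c + y)) s, integral_add_left_eq_self f c,
    abs_of_pos (by positivity), Complex.real_smul, ← mul_assoc]
  push_cast
  rw [mul_inv_cancel₀ (by exact_mod_cast hs.ne'), one_mul]

theorem wavePacket_rescale (ψ : SchwartzMap ℝ ℂ) (x₀ ξ₀ u : ℝ) {s : ℝ} (hs : 0 < s) :
    wavePacket ψ x₀ ξ₀ (s ^ 2) (x₀ + s * u) = ((s ^ (-(1 / 2 : ℝ)) : ℝ) : ℂ) * ψ u *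
      Complex.exp (Complex.I * ((x₀ + s * u : ℝ) : ℂ) * ξ₀ / (s : ℂ) ^ 2) := by
  have h1 : (s ^ 2) ^ (-(1 / 4 : ℝ)) = s ^ (-(1 / 2 : ℝ)) := by
    rw [← Real.rpow_natCast, ← Real.rpow_mul hs.le]; norm_num
  have h2 : (x₀ + s * u - x₀) / s = u := by field_simp; ring
  rw [wavePacket, h1, Real.sqrt_sq hs.le, h2]
  push_cast
  rfl

theorem inner_weyl_wavePacket_rescale (ψ : SchwartzMap ℝ ℂ) (x₀ ξ₀ : ℝ) (a : ℝ × ℝ → ℂ)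
    {s : ℝ} (hs : 0 < s) :
    ∫ x : ℝ, (starRingEnd ℂ) (wavePacket ψ x₀ ξ₀ (s ^ 2) x) *
      ((1 / (2 * (Real.pi : ℂ) * ((s ^ 2 : ℝ) : ℂ))) *
        ∫ ξ : ℝ, ∫ y : ℝ,
          Complex.exp (Complex.I / ((s ^ 2 : ℝ) : ℂ) * (ξ : ℂ) * ((x : ℂ) - (y : ℂ))) *
            a ((x + y) / 2, ξ) * wavePacket ψ x₀ ξ₀ (s ^ 2) y) =
    ∫ u : ℝ, (starRingEnd ℂ) (ψ u) * ((2 * (Real.pi : ℂ))⁻¹ *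
      ∫ η : ℝ, ∫ v : ℝ, Complex.exp (Complex.I * η * (u - v)) *
        (a (x₀ + s * ((u + v) / 2), ξ₀ + s * η) * ψ v)) := by
  have hsc : (s : ℂ) ≠ 0 := by exact_mod_cast hs.ne'
  have hr : ((s ^ (-(1 / 2 : ℝ)) : ℝ) : ℂ) * ((s ^ (-(1 / 2 : ℝ)) : ℝ) : ℂ) * s = 1 := by
    have : s ^ (-(1 / 2 : ℝ)) * s ^ (-(1 / 2 : ℝ)) * s = 1 := by
      rw [← Real.rpow_add hs]; norm_num
      rw [Real.rpow_neg_one, inv_mul_cancel₀ hs.ne']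
    exact_mod_cast this
  set r : ℂ := ((s ^ (-(1 / 2 : ℝ)) : ℝ) : ℂ) with hrdef
  rw [integral_eq_mul_integral_comp_add_mul _ x₀ hs, ← integral_const_mul]
  refine integral_congr_ae (.of_forall fun u => ?_)
  simp only
  rw [integral_eq_mul_integral_comp_add_mul _ ξ₀ hs]
  have hin : ∀ η : ℝ, ∫ y : ℝ,
      Complex.exp (Complex.I / ((s ^ 2 : ℝ) : ℂ) * ((ξ₀ + s * η : ℝ) : ℂ) *
        (((x₀ + s * u : ℝ) : ℂ) - (y : ℂ))) *
          a ((x₀ + s * u + y) / 2, ξ₀ + s * η) * wavePacket ψ x₀ ξ₀ (s ^ 2) y =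
      (s * r * Complex.exp (Complex.I * ((x₀ + s * u : ℝ) : ℂ) * ξ₀ / (s : ℂ) ^ 2)) *
        ∫ v : ℝ, Complex.exp (Complex.I * η * (u - v)) *
        (a (x₀ + s * ((u + v) / 2), ξ₀ + s * η) * ψ v) := by
    intro η
    rw [integral_eq_mul_integral_comp_add_mul _ x₀ hs, ← integral_const_mul,
      ← integral_const_mul]
    refine integral_congr_ae (.of_forall fun v => ?_)
    simp only
    rw [wavePacket_rescale ψ x₀ ξ₀ v hs, ← hrdef]
    have e1 : (x₀ + s * u + (x₀ + s * v)) / 2 = x₀ + s * ((u + v) / 2) := by ring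
    have e2 : Complex.exp (Complex.I / ((s ^ 2 : ℝ) : ℂ) * ((ξ₀ + s * η : ℝ) : ℂ) *
        (((x₀ + s * u : ℝ) : ℂ) - ((x₀ + s * v : ℝ) : ℂ))) *
        Complex.exp (Complex.I * ((x₀ + s * v : ℝ) : ℂ) * ξ₀ / (s : ℂ) ^ 2) =
        Complex.exp (Complex.I * ((x₀ + s * u : ℝ) : ℂ) * ξ₀ / (s : ℂ) ^ 2) *
          Complex.exp (Complex.I * η * (u - v)) := by
      rw [← Complex.exp_add, ← Complex.exp_add]
      congr 1
      push_cast
      field_simp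
      ring
    rw [e1]
    linear_combination (s * a (x₀ + s * ((u + v) / 2), ξ₀ + s * η) * r * ψ v) * e2
  simp only [hin]
  rw [integral_const_mul, wavePacket_rescale ψ x₀ ξ₀ u hs, ← hrdef]
  have e3 : (starRingEnd ℂ) (Complex.exp (Complex.I * ((x₀ + s * u : ℝ) : ℂ) * ξ₀ / (s : ℂ) ^ 2)) *
      Complex.exp (Complex.I * ((x₀ + s * u : ℝ) : ℂ) * ξ₀ / (s : ℂ) ^ 2) = 1 := by
    rw [← Complex.exp_conj, ← Complex.exp_add]
    simp only [map_div₀, map_mul, map_pow, Complex.conj_I, Complex.conj_ofReal]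
    ring_nf
    simp
  have e4 : (starRingEnd ℂ) r = r := Complex.conj_ofReal _
  simp only [map_mul, e4]
  generalize Complex.exp (Complex.I * ((x₀ + s * u : ℝ) : ℂ) * ξ₀ / (s : ℂ) ^ 2) = E at *
  generalize (∫ η : ℝ, ∫ v : ℝ, Complex.exp (Complex.I * η * (u - v)) *
        (a (x₀ + s * ((u + v) / 2), ξ₀ + s * η) * ψ v)) = J
  have hpi : (Real.pi : ℂ) ≠ 0 := by exact_mod_cast Real.pi_ne_zero
  push_cast
  have : (1 / (2 * (Real.pi : ℂ) * (s : ℂ) ^ 2)) * s * s = (2 * (Real.pi : ℂ))⁻¹ := by field_simp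
  rw [← this]
  linear_combination ((starRingEnd ℂ) (ψ u) * J * (1 / (2 * (Real.pi : ℂ) * (s : ℂ) ^ 2)) * s * s) *
    (r * r * s * e3 + hr)

theorem tendsto_rescaled_inner_weyl (ψ : SchwartzMap ℝ ℂ) (hψ : (∫ x : ℝ, ‖ψ x‖ ^ 2) = 1)
    (x₀ ξ₀ : ℝ) {a : ℝ × ℝ → ℂ} (ha : ContDiff ℝ (⊤ : ℕ∞) a) (hsupp : HasCompactSupport a) :
    Filter.Tendsto (fun s : ℝ => ∫ u : ℝ, (starRingEnd ℂ) (ψ u) * ((2 * (Real.pi : ℂ))⁻¹ *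
      ∫ η : ℝ, ∫ v : ℝ, Complex.exp (Complex.I * η * (u - v)) *
        (a (x₀ + s * ((u + v) / 2), ξ₀ + s * η) * ψ v)))
      (nhdsWithin 0 (Set.Ioi 0)) (nhds (a (x₀, ξ₀))) := by
  obtain ⟨C, hC, hbd⟩ := exists_bound_integral_scaled_symbol ψ x₀ ξ₀ ha hsupp
  obtain ⟨M, hM⟩ := hsupp.exists_bound_of_continuous ha.continuous
  have hac := ha.continuous
  have hψc := ψ.continuous
  have hcont : ∀ s : ℝ, Continuous fun p : (ℝ × ℝ) × ℝ =>
      Complex.exp (Complex.I * p.1.2 * (p.1.1 - p.2)) *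
        (a (x₀ + s * ((p.1.1 + p.2) / 2), ξ₀ + s * p.1.2) * ψ p.2) := fun s => by fun_prop
  have hm1 : ∀ s : ℝ, StronglyMeasurable fun p : ℝ × ℝ => ∫ v : ℝ,
      Complex.exp (Complex.I * p.2 * (p.1 - v)) *
        (a (x₀ + s * ((p.1 + v) / 2), ξ₀ + s * p.2) * ψ v) := fun s =>
    (hcont s).stronglyMeasurable.integral_prod_right'
  have hm2 : ∀ s : ℝ, StronglyMeasurable fun u : ℝ => ∫ η : ℝ, ∫ v : ℝ,
      Complex.exp (Complex.I * η * (u - v)) *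
        (a (x₀ + s * ((u + v) / 2), ξ₀ + s * η) * ψ v) := fun s =>
    (hm1 s).integral_prod_right'
  have hev : ∀ᶠ s : ℝ in nhdsWithin 0 (Set.Ioi 0), 0 ≤ s ∧ s ≤ 1 := by
    filter_upwards [Ioc_mem_nhdsGT (zero_lt_one' ℝ)] with s hs using ⟨hs.1.le, hs.2⟩
  have hv : ∀ u η : ℝ, Filter.Tendsto (fun s : ℝ => ∫ v : ℝ,
      Complex.exp (Complex.I * η * (u - v)) *
        (a (x₀ + s * ((u + v) / 2), ξ₀ + s * η) * ψ v)) (nhdsWithin 0 (Set.Ioi 0))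
      (nhds (∫ v : ℝ, Complex.exp (Complex.I * η * (u - v)) * (a (x₀, ξ₀) * ψ v))) := by
    intro u η
    refine tendsto_integral_filter_of_dominated_convergence (fun v => M * ‖ψ v‖)
      (.of_forall fun s => (by fun_prop : Continuous _).aestronglyMeasurable)
      (.of_forall fun s => .of_forall fun v => ?_) (ψ.integrable.norm.const_mul M)
      (.of_forall fun v => ?_)
    · rw [norm_mul, norm_cexp_I_mul_mul_sub, one_mul, norm_mul]
      exact mul_le_mul_of_nonneg_right (hM _) (norm_nonneg _)
    · refine tendsto_nhdsWithin_of_tendsto_nhds (Continuous.tendsto' ?_ _ _ (by simp))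
      fun_prop
  have hη : ∀ u : ℝ, Filter.Tendsto (fun s : ℝ => ∫ η : ℝ, ∫ v : ℝ,
      Complex.exp (Complex.I * η * (u - v)) *
        (a (x₀ + s * ((u + v) / 2), ξ₀ + s * η) * ψ v)) (nhdsWithin 0 (Set.Ioi 0))
      (nhds (∫ η : ℝ, ∫ v : ℝ,
        Complex.exp (Complex.I * η * (u - v)) * (a (x₀, ξ₀) * ψ v))) := by
    intro u
    refine tendsto_integral_filter_of_dominated_convergence (fun η => C * (1 + η ^ 2)⁻¹)
      (.of_forall fun s =>
        ((hm1 s).comp_measurable (measurable_prodMk_left (x := u))).aestronglyMeasurable)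
      ?_ (integrable_inv_one_add_sq.const_mul C) (.of_forall fun η => hv u η)
    filter_upwards [hev] with s hs using .of_forall fun η => hbd s hs.1 hs.2 u η
  have hlim : ∀ u : ℝ, (2 * (Real.pi : ℂ))⁻¹ * ∫ η : ℝ, ∫ v : ℝ,
      Complex.exp (Complex.I * η * (u - v)) * (a (x₀, ξ₀) * ψ v) = a (x₀, ξ₀) * ψ u := by
    intro u
    simp only [mul_left_comm _ (a (x₀, ξ₀)), integral_const_mul, ψ.integral_integral_cexp_mul]
    have hpi : (Real.pi : ℂ) ≠ 0 := by exact_mod_cast Real.pi_ne_zero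
    field_simp
  have hfin : ∫ u : ℝ, (starRingEnd ℂ) (ψ u) * (a (x₀, ξ₀) * ψ u) = a (x₀, ξ₀) := by
    have : ∀ u : ℝ, (starRingEnd ℂ) (ψ u) * (a (x₀, ξ₀) * ψ u) =
        a (x₀, ξ₀) * ((‖ψ u‖ ^ 2 : ℝ) : ℂ) := fun u => by
      rw [mul_left_comm, Complex.conj_mul']; push_cast; rfl
    simp only [this]
    rw [integral_const_mul, integral_complex_ofReal, hψ]
    simp
  have hmain : Filter.Tendsto (fun s : ℝ => ∫ u : ℝ, (starRingEnd ℂ) (ψ u) *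
      ((2 * (Real.pi : ℂ))⁻¹ * ∫ η : ℝ, ∫ v : ℝ, Complex.exp (Complex.I * η * (u - v)) *
        (a (x₀ + s * ((u + v) / 2), ξ₀ + s * η) * ψ v))) (nhdsWithin 0 (Set.Ioi 0))
      (nhds (∫ u : ℝ, (starRingEnd ℂ) (ψ u) * (a (x₀, ξ₀) * ψ u))) := by
    refine tendsto_integral_filter_of_dominated_convergence
      (fun u => ‖ψ u‖ * (‖(2 * (Real.pi : ℂ))⁻¹‖ * (C * Real.pi)))
      (.of_forall fun s => ?_) ?_ (ψ.integrable.norm.mul_const _) (.of_forall fun u => ?_)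
    · have hconj : Continuous fun u => (starRingEnd ℂ) (ψ u) := Complex.continuous_conj.comp hψc
      exact hconj.aestronglyMeasurable.mul ((hm2 s).const_mul _).aestronglyMeasurable
    · filter_upwards [hev] with s hs
      refine .of_forall fun u => ?_
      rw [norm_mul, norm_mul, RCLike.norm_conj]
      gcongr
      refine (norm_integral_le_of_norm_le (integrable_inv_one_add_sq.const_mul C)
        (.of_forall fun η => hbd s hs.1 hs.2 u η)).trans_eq ?_
      rw [integral_const_mul, integral_univ_inv_one_add_sq]
    · rw [← hlim u]
      exact ((hη u).const_mul _).const_mul _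
  rwa [hfin] at hmain

/-- For a normalised Schwartz wave packet concentrating at `(x₀, ξ₀)` and a
smooth compactly supported symbol `a`, the expectation value of the Weyl
quantisation `op_hb(a)` in the state `ψ^hb`,
`⟨ψ^hb, op_hb(a) ψ^hb⟩ = ∫ conj(ψ^hb(x)) (1/(2πhb)) ∫∫ e^{(i/hb)ξ(x−y)} a((x+y)/2, ξ) ψ^hb(y) dy dξ dx`,
converges to `a(x₀, ξ₀)` as `hb → 0⁺`. -/
theorem semiclassical_limit_wavePacket (ψ : SchwartzMap ℝ ℂ)
    (hψ : (∫ x : ℝ, ‖ψ x‖ ^ 2) = 1)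
    (x₀ ξ₀ : ℝ) (a : ℝ × ℝ → ℂ) (ha : ContDiff ℝ (⊤ : ℕ∞) a) (hsupp : HasCompactSupport a) :
    Filter.Tendsto
      (fun hb : ℝ =>
        ∫ x : ℝ, (starRingEnd ℂ) (wavePacket ψ x₀ ξ₀ hb x) *
          ((1 / (2 * (Real.pi : ℂ) * (hb : ℂ))) *
            ∫ ξ : ℝ, ∫ y : ℝ,
              Complex.exp (Complex.I / (hb : ℂ) * (ξ : ℂ) * ((x : ℂ) - (y : ℂ))) *
                a ((x + y) / 2, ξ) * wavePacket ψ x₀ ξ₀ hb y))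
      (nhdsWithin 0 (Set.Ioi 0)) (nhds (a (x₀, ξ₀))) := by
  have hsqrt : Filter.Tendsto Real.sqrt (nhdsWithin 0 (Set.Ioi 0)) (nhdsWithin 0 (Set.Ioi 0)) := by
    refine tendsto_nhdsWithin_iff.2 ⟨tendsto_nhdsWithin_of_tendsto_nhds
      (Real.continuous_sqrt.tendsto' 0 0 Real.sqrt_zero), ?_⟩
    filter_upwards [self_mem_nhdsWithin] with t ht using Real.sqrt_pos.2 ht
  refine ((tendsto_rescaled_inner_weyl ψ hψ x₀ ξ₀ ha hsupp).comp hsqrt).congr' ?_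
  filter_upwards [self_mem_nhdsWithin] with t ht
  have h := inner_weyl_wavePacket_rescale ψ x₀ ξ₀ a (Real.sqrt_pos.2 ht)
  rw [Real.sq_sqrt (le_of_lt ht)] at h
  exact h.symm
end

section
/- Let 𝔄 be a unital C*-algebra, ω a state on 𝔄, and (H, π, Ω) a cyclic representation of 𝔄 for ω, i.e., π : 𝔄 → B(H) is a unital *-homomorphism, Ω ∈ H, the set { π(a)Ω : a ∈ 𝔄 } is dense in H, and ⟨Ω, π(a)Ω⟩ = ω(a) for all a ∈ 𝔄. Then ω is a pure state if and only if π is irreducible, i.e., the only closed linear subspaces U ⊆ H with π(a)U ⊆ U for every a ∈ 𝔄 are U = {0} and U = H. -/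
open scoped ComplexOrder ComplexInnerProductSpace

/-- A state is pure if any decomposition of it as a convex combination
`λω₁ + (1−λ)ω₂` of states with `λ ∈ (0,1)` forces `ω₁ = ω₂`. -/
def IsPureState {A : Type*} [Ring A] [Algebra ℂ A] [Star A] (ω : A → ℂ) : Prop :=
  IsState ω ∧
    ∀ ω₁ ω₂ : A → ℂ, IsState ω₁ → IsState ω₂ →
      ∀ l : ℝ, l ∈ Set.Ioo (0 : ℝ) 1 →
        (∀ a : A, ω a = (l : ℂ) * ω₁ a + (1 - (l : ℂ)) * ω₂ a) → ω₁ = ω₂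

section Form

theorem inner_self_eq_ofReal_norm_sq {H : Type*} [NormedAddCommGroup H] [InnerProductSpace ℂ H]
    (x : H) : ⟪x, x⟫ = ((‖x‖ ^ 2 : ℝ) : ℂ) := by
  rw [inner_self_eq_norm_sq_to_K]
  simp

variable {E H : Type*} [AddCommGroup E] [Module ℂ E]
  [NormedAddCommGroup H] [InnerProductSpace ℂ H] [CompleteSpace H]

/-- A sesquilinear form on `E` that is bounded with respect to a linear map `e : E → H` with dense
range is represented by a bounded operator on `H`. -/
theorem exists_clm_inner_eq_of_dense (e : E →ₗ[ℂ] H) (he : DenseRange e)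
    (B : E →ₗ⋆[ℂ] E →ₗ[ℂ] ℂ) (C : ℝ) (hC : 0 ≤ C)
    (hB : ∀ a b, ‖B a b‖ ≤ C * ‖e a‖ * ‖e b‖) :
    ∃ T : H →L[ℂ] H, ∀ a b, ⟪T (e a), e b⟫ = B a b := by
  have hη : ∀ a, ∃ η : H, ‖η‖ ≤ C * ‖e a‖ ∧ ∀ b, ⟪η, e b⟫ = B a b := fun a ↦
    ⟨(InnerProductSpace.toDual ℂ H).symm ((B a).extendOfNorm e), by
      rw [LinearIsometryEquiv.norm_map]
      exact LinearMap.opNorm_extendOfNorm_le he (by positivity) (hB a), fun b ↦ by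
      rw [InnerProductSpace.toDual_symm_apply]
      exact LinearMap.extendOfNorm_eq he ⟨_, hB a⟩ b⟩
  choose η hηn hηi using hη
  have ext_dense : ∀ x y : H, (∀ b, ⟪x, e b⟫ = ⟪y, e b⟫) → x = y := fun x y h ↦
    ext_inner_right ℂ fun v ↦ congrFun (he.equalizer (Continuous.inner continuous_const continuous_id)
      (Continuous.inner continuous_const continuous_id) (funext h)) v
  let f : E →ₗ[ℂ] H :=
    { toFun := η
      map_add' := fun a b ↦ ext_dense _ _ fun v ↦ by simp [hηi]
      map_smul' := fun c a ↦ ext_dense _ _ fun v ↦ by simp [hηi, mul_comm] }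
  refine ⟨f.extendOfNorm e, fun a b ↦ ?_⟩
  rw [LinearMap.extendOfNorm_eq he ⟨C, hηn⟩ a]
  exact hηi a b

end Form

section Schur

variable {H : Type*} [NormedAddCommGroup H] [InnerProductSpace ℂ H] [CompleteSpace H]

/-- Schur's lemma: a self-adjoint operator commuting with an irreducible set of operators is a
scalar. -/
theorem exists_eq_algebraMap_of_irreducible (S : Set (H →L[ℂ] H))
    (hS : ∀ U : Submodule ℂ H, IsClosed (U : Set H) →
      (∀ s ∈ S, ∀ x ∈ U, s x ∈ U) → U = ⊥ ∨ U = ⊤)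
    (T : H →L[ℂ] H) (hT : IsSelfAdjoint T) (hcomm : ∀ s ∈ S, Commute T s) :
    ∃ c : ℝ, T = algebraMap ℝ (H →L[ℂ] H) c := by
  have hsub : (spectrum ℝ T).Subsingleton := by
    by_contra hns
    obtain ⟨x, hx, y, hy, hxy⟩ := (Set.not_subsingleton_iff.1 hns).exists_lt
    set m := (x + y) / 2
    set F := cfc (fun t : ℝ ↦ max (t - m) 0) T with hF
    set G := cfc (fun t : ℝ ↦ max (m - t) 0) T with hG
    have hFG : F * G = 0 := by
      rw [hF, hG, ← cfc_mul _ _ T, ← cfc_zero ℝ T]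
      congr 1
      ext t
      rcases le_total t m with h | h <;> simp [h]
    have hvanish : ∀ f : ℝ → ℝ, Continuous f → cfc f T = 0 → ∀ t ∈ spectrum ℝ T, f t = 0 := by
      intro f hf h0 t ht
      have h := (cfc_eq_cfc_iff_eqOn (f := f) (g := 0) (a := T)
        (hf := hf.continuousOn) (hg := continuousOn_const)).1 (by rw [h0, cfc_zero])
      exact h ht
    have hker := hS (LinearMap.ker F.toLinearMap) F.isClosed_ker fun s hs v hv ↦ by
      have h := (hcomm s hs).cfc_real (fun t : ℝ ↦ max (t - m) 0)
      have h' := congrArg (fun L : H →L[ℂ] H ↦ L v) h.eq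
      have hv' : F v = 0 := hv
      change F (s v) = 0
      change F (s v) = s (F v) at h'
      rw [h', hv', map_zero]
    rcases hker with h | h
    · have hG0 : G = 0 := by
        ext v
        have : G v ∈ LinearMap.ker F.toLinearMap :=
          congrArg (fun L : H →L[ℂ] H ↦ L v) hFG
        rw [h] at this
        exact this
      have := hvanish _ (by fun_prop) hG0 x hx
      simp only [m, max_eq_right_iff] at this
      linarith
    · have hF0 : F = 0 := by
        ext v
        have : v ∈ LinearMap.ker F.toLinearMap := h ▸ Submodule.mem_top
        exact this
      have := hvanish _ (by fun_prop) hF0 y hy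
      simp only [m, max_eq_right_iff] at this
      linarith
  rcases hsub.eq_empty_or_singleton with h | ⟨c, h⟩
  · exact ⟨0, CFC.eq_algebraMap_of_spectrum_subset_singleton T 0 (by simp [h])⟩
  · exact ⟨c, CFC.eq_algebraMap_of_spectrum_subset_singleton T c h.le⟩

end Schur

section State

variable {A : Type*} [Ring A] [StarRing A] [Algebra ℂ A] [StarModule ℂ A] {ω : A → ℂ}

/-- The sesquilinear form `(a, b) ↦ ω (a* b)` of a state. -/
def IsState.form (h : IsState ω) : A →ₗ⋆[ℂ] A →ₗ[ℂ] ℂ :=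
  LinearMap.mk₂'ₛₗ (starRingEnd ℂ) (RingHom.id ℂ) (fun a b ↦ ω (star a * b))
    (fun a b c ↦ by simp [add_mul, h.1])
    (fun c a b ↦ by simp [h.2.1])
    (fun a b c ↦ by simp [mul_add, h.1])
    (fun c a b ↦ by simp [h.2.1])

theorem IsState.form_apply (h : IsState ω) (a b : A) : h.form a b = ω (star a * b) := rfl

theorem IsState.form_self_nonneg (h : IsState ω) (a : A) : 0 ≤ h.form a a := h.2.2.1 a

theorem IsState.conj_form (h : IsState ω) (a b : A) :
    starRingEnd ℂ (h.form b a) = h.form a b := by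
  have h0 := fun x ↦ (Complex.nonneg_iff.1 (h.form_self_nonneg x)).2
  have h1 := h0 (a + b)
  have h2 := h0 (a + Complex.I • b)
  have ha := h0 a
  have hb := h0 b
  simp only [map_add, LinearMap.add_apply, map_smul, LinearMap.map_smulₛₗ, LinearMap.smul_apply,
    smul_eq_mul, Complex.conj_I, Complex.add_im, Complex.mul_im, Complex.neg_im,
    Complex.add_re, Complex.mul_re, Complex.neg_re, Complex.I_re, Complex.I_im] at h1 h2
  apply Complex.ext <;> simp <;> linarith

/-- The Cauchy–Schwarz inequality for states. -/
theorem IsState.norm_form_sq_le (h : IsState ω) (a b : A) :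
    ‖h.form a b‖ ^ 2 ≤ (h.form a a).re * (h.form b b).re := by
  let c : PreInnerProductSpace.Core ℂ A :=
    { inner := fun a b ↦ h.form a b
      conj_inner_symm := h.conj_form
      re_inner_nonneg := fun a ↦ (Complex.nonneg_iff.1 (h.form_self_nonneg a)).1
      add_left := fun a b c ↦ by simp
      smul_left := fun a b c ↦ by simp }
  have := InnerProductSpace.Core.inner_mul_inner_self_le (c := c) a b
  rw [InnerProductSpace.Core.norm_inner_symm b a, ← sq] at this
  exact this

end State

section Representation

variable {A : Type*} [Ring A] [StarRing A] [Algebra ℂ A]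
  {H : Type*} [NormedAddCommGroup H] [InnerProductSpace ℂ H] [CompleteSpace H]

/-- The normalised vector functional of a nonzero vector is a state. -/
theorem isState_vector (π : A →⋆ₐ[ℂ] (H →L[ℂ] H)) (x : H) (hx : x ≠ 0) :
    IsState fun a : A ↦ ((‖x‖ ^ 2 : ℝ) : ℂ)⁻¹ * ⟪x, π a x⟫ := by
  refine ⟨fun a b ↦ by simp [mul_add],
    fun c a ↦ by simp [mul_left_comm], fun a ↦ ?_, ?_⟩
  · simp only [map_mul, map_star]
    rw [mul_apply_eq_comp, ContinuousLinearMap.star_eq_adjoint,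
      ContinuousLinearMap.adjoint_inner_right, inner_self_eq_ofReal_norm_sq]
    have : (0 : ℝ) ≤ (‖x‖ ^ 2)⁻¹ * ‖π a x‖ ^ 2 := by positivity
    exact_mod_cast this
  · have : (‖x‖ : ℂ) ≠ 0 := by simpa using hx
    simp [this]

/-- The orthogonal projection onto a closed invariant subspace of a representation lies in its
commutant. -/
theorem starProjection_apply_of_invariant (π : A →⋆ₐ[ℂ] (H →L[ℂ] H)) (U : Submodule ℂ H)
    [U.HasOrthogonalProjection] (hU : ∀ a : A, ∀ x ∈ U, π a x ∈ U) (a : A) (x : H) :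
    U.starProjection (π a x) = π a (U.starProjection x) := by
  refine Submodule.eq_starProjection_of_mem_orthogonal (hU a _ (U.starProjection_apply_mem x)) ?_
  rw [← map_sub, Submodule.mem_orthogonal]
  intro u hu
  rw [← ContinuousLinearMap.adjoint_inner_left, ← ContinuousLinearMap.star_eq_adjoint, ← map_star]
  exact (Submodule.mem_orthogonal _ _).1 (U.sub_starProjection_mem_orthogonal x) _ (hU _ u hu)

theorem IsPureState.eq_bot_or_eq_top {ω : A → ℂ} (hω : IsPureState ω)
    (π : A →⋆ₐ[ℂ] (H →L[ℂ] H)) (Ω : H) (hcyclic : DenseRange fun a : A ↦ π a Ω)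
    (hvec : ∀ a : A, ⟪Ω, π a Ω⟫ = ω a) (U : Submodule ℂ H) (hUc : IsClosed (U : Set H))
    (hU : ∀ a : A, ∀ x ∈ U, π a x ∈ U) : U = ⊥ ∨ U = ⊤ := by
  have : CompleteSpace U := hUc.completeSpace_coe
  set P := U.starProjection with hP
  have hPπ : ∀ a x, P (π a x) = π a (P x) := starProjection_apply_of_invariant π U hU
  have hPx (x : H) : P x ∈ U := U.starProjection_apply_mem x
  have hPo (x : H) : x - P x ∈ Uᗮ := U.sub_starProjection_mem_orthogonal x
  by_cases h0 : P Ω = 0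
  · left
    have hz : P = 0 := by
      ext x
      exact congrFun (hcyclic.equalizer P.continuous continuous_const
        (funext fun a ↦ by simp [hPπ, h0] : _ = (fun _ ↦ (0 : H)) ∘ _)) x
    refine (Submodule.eq_bot_iff _).2 fun x hx ↦ ?_
    rw [← Submodule.starProjection_eq_self_iff.2 hx, ← hP, hz]
    rfl
  by_cases h1 : Ω - P Ω = 0
  · right
    have hz : (P : H → H) = id := hcyclic.equalizer (by fun_prop) (by fun_prop)
        (funext fun a ↦ by simp [hPπ, ← sub_eq_zero.1 h1])
    refine Submodule.eq_top_iff'.2 fun x ↦ ?_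
    rw [← id_eq x, ← hz]
    exact hPx x
  exfalso
  have horth (a : A) : (⟪P Ω, π a (Ω - P Ω)⟫ : ℂ) = 0 := by
    rw [map_sub, ← hPπ]
    exact (Submodule.mem_orthogonal _ _).1 (hPo _) _ (hPx _)
  have horth' (a : A) : (⟪Ω - P Ω, π a (P Ω)⟫ : ℂ) = 0 := by
    rw [← hPπ]
    exact (Submodule.mem_orthogonal' _ _).1 (hPo _) _ (hPx _)
  have hsum (a : A) : ω a = ⟪P Ω, π a (P Ω)⟫ + ⟪Ω - P Ω, π a (Ω - P Ω)⟫ := by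
    have h2 := horth a
    have h3 := horth' a
    rw [map_sub, inner_sub_right] at h2
    rw [inner_sub_left] at h3
    rw [← hvec, map_sub, inner_sub_left, inner_sub_right, inner_sub_right]
    linear_combination h2 + h3
  have hnorm : ‖Ω - P Ω‖ ^ 2 = 1 - ‖P Ω‖ ^ 2 := by
    have h := hsum 1
    simp only [hω.1.2.2.2, map_one, one_apply_eq_self,
      inner_self_eq_ofReal_norm_sq] at h
    have h' : (1 : ℝ) = ‖P Ω‖ ^ 2 + ‖Ω - P Ω‖ ^ 2 := by exact_mod_cast h
    linarith
  have hp0 : 0 < ‖P Ω‖ ^ 2 := by positivity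
  have hp1 : 0 < ‖Ω - P Ω‖ ^ 2 := by positivity
  have hc0 : ((‖P Ω‖ ^ 2 : ℝ) : ℂ) ≠ 0 := by exact_mod_cast hp0.ne'
  have hc1 : ((‖Ω - P Ω‖ ^ 2 : ℝ) : ℂ) ≠ 0 := by exact_mod_cast hp1.ne'
  have heq := hω.2 _ _ (isState_vector π (P Ω) h0) (isState_vector π (Ω - P Ω) h1) (‖P Ω‖ ^ 2)
    ⟨hp0, by linarith⟩ fun a ↦ by
      rw [← Complex.ofReal_one, ← Complex.ofReal_sub, ← hnorm, mul_inv_cancel_left₀ hc0,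
        mul_inv_cancel_left₀ hc1, hsum]
  have hPΩ (a : A) : ⟪P Ω, π a Ω⟫ = ⟪((‖P Ω‖ ^ 2 : ℝ) : ℂ) • Ω, π a Ω⟫ := by
    have h2 := congrFun heq a
    have h3 := horth a
    rw [map_sub, inner_sub_right] at h3
    rw [inner_smul_left, Complex.conj_ofReal, hvec, hsum, sub_eq_zero.1 h3]
    have h5 : ((‖Ω - P Ω‖ ^ 2 : ℝ) : ℂ) = 1 - ((‖P Ω‖ ^ 2 : ℝ) : ℂ) := by
      rw [hnorm]; push_cast; ring
    have h6 : ((‖Ω - P Ω‖ ^ 2 : ℝ) : ℂ) * ⟪P Ω, π a (P Ω)⟫ =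
        ((‖P Ω‖ ^ 2 : ℝ) : ℂ) * ⟪Ω - P Ω, π a (Ω - P Ω)⟫ := by
      rw [inv_mul_eq_div, inv_mul_eq_div, div_eq_div_iff hc0 hc1] at h2
      linear_combination h2
    rw [h5] at h6
    linear_combination h6
  have hscal : P Ω = ((‖P Ω‖ ^ 2 : ℝ) : ℂ) • Ω := ext_inner_right ℂ fun v ↦
    congrFun (hcyclic.equalizer (Continuous.inner continuous_const continuous_id)
      (Continuous.inner continuous_const continuous_id) (funext hPΩ)) v
  have hΩU : Ω ∈ U := (U.smul_mem_iff hc0).1 (hscal ▸ hPx Ω)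
  exact h1 (by rw [hP, Submodule.starProjection_eq_self_iff.2 hΩU, sub_self])

variable [StarModule ℂ A]

/-- A state `φ` dominated by the vector functional of a cyclic vector `Ω` of an irreducible
representation is equal to that vector functional, up to a scalar. -/
theorem IsState.exists_eq_smul_of_dominated (π : A →⋆ₐ[ℂ] (H →L[ℂ] H)) (Ω : H)
    (hcyclic : DenseRange fun a : A ↦ π a Ω)
    (hirr : ∀ U : Submodule ℂ H, IsClosed (U : Set H) →
      (∀ a : A, ∀ x ∈ U, π a x ∈ U) → U = ⊥ ∨ U = ⊤)
    {φ : A → ℂ} (hφ : IsState φ) (C : ℝ) (hC : 0 ≤ C)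
    (hdom : ∀ a, (φ (star a * a)).re ≤ C * ‖π a Ω‖ ^ 2) :
    ∃ c : ℂ, ∀ a, φ a = c * ⟪Ω, π a Ω⟫ := by
  let e : A →ₗ[ℂ] H :=
    { toFun := fun a ↦ π a Ω
      map_add' := by simp
      map_smul' := by simp }
  have he : DenseRange e := hcyclic
  have hmul (a b : A) : π a (e b) = e (a * b) := by simp [e]
  obtain ⟨T, hT⟩ := exists_clm_inner_eq_of_dense e he hφ.form C hC fun a b ↦ by
    refine le_of_sq_le_sq ?_ (by positivity)
    calc ‖hφ.form a b‖ ^ 2 ≤ (hφ.form a a).re * (hφ.form b b).re := hφ.norm_form_sq_le a b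
      _ ≤ (C * ‖e a‖ ^ 2) * (C * ‖e b‖ ^ 2) :=
        mul_le_mul (hdom a) (hdom b) (Complex.nonneg_iff.1 (hφ.form_self_nonneg b)).1
          (by positivity)
      _ = (C * ‖e a‖ * ‖e b‖) ^ 2 := by ring
  have hsa : IsSelfAdjoint T := by
    rw [ContinuousLinearMap.isSelfAdjoint_iff_isSymmetric]
    intro x y
    refine he.induction_on₂ (p := fun x y ↦ ⟪T x, y⟫ = ⟪x, T y⟫)
      (isClosed_eq (by fun_prop) (by fun_prop)) (fun a b ↦ ?_) x y
    rw [hT, ← inner_conj_symm, hT, hφ.conj_form]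
  obtain ⟨c, hc⟩ := exists_eq_algebraMap_of_irreducible (Set.range π)
    (fun U hU h ↦ hirr U hU fun a ↦ h _ ⟨a, rfl⟩) T hsa <| by
      rintro _ ⟨a, rfl⟩
      have key (x y : H) : ⟪T (π a x), y⟫ = ⟪π a (T x), y⟫ := by
        refine he.induction_on₂ (p := fun x y ↦ ⟪T (π a x), y⟫ = ⟪π a (T x), y⟫)
          (isClosed_eq (by fun_prop) (by fun_prop)) (fun b d ↦ ?_) x y
        rw [hmul, hT, ← ContinuousLinearMap.adjoint_inner_right,
          ← ContinuousLinearMap.star_eq_adjoint, ← map_star, hmul, hT]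
        simp [hφ.form_apply, mul_assoc]
      ext x
      exact ext_inner_right ℂ (key x)
  refine ⟨c, fun a ↦ ?_⟩
  have h1 := hT 1 a
  have h2 : T (e 1) = (c : ℂ) • Ω := by
    rw [hc, Algebra.algebraMap_eq_smul_one]
    simp [e]
  rw [h2, inner_smul_left, Complex.conj_ofReal] at h1
  rw [show (⟪Ω, π a Ω⟫ : ℂ) = ⟪Ω, e a⟫ from rfl, h1, hφ.form_apply, star_one, one_mul]

theorem isPureState_of_irreducible {ω : A → ℂ} (hω : IsState ω)
    (π : A →⋆ₐ[ℂ] (H →L[ℂ] H)) (Ω : H) (hcyclic : DenseRange fun a : A ↦ π a Ω)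
    (hvec : ∀ a : A, ⟪Ω, π a Ω⟫ = ω a)
    (hirr : ∀ U : Submodule ℂ H, IsClosed (U : Set H) →
      (∀ a : A, ∀ x ∈ U, π a x ∈ U) → U = ⊥ ∨ U = ⊤) : IsPureState ω := by
  refine ⟨hω, fun ω₁ ω₂ h₁ h₂ l ⟨hl0, hl1⟩ hsum ↦ ?_⟩
  have hdom (a : A) : (ω₁ (star a * a)).re ≤ l⁻¹ * ‖π a Ω‖ ^ 2 := by
    have h := congrArg Complex.re (hsum (star a * a))
    rw [← hvec, map_mul, map_star, mul_apply_eq_comp,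
      ContinuousLinearMap.star_eq_adjoint, ContinuousLinearMap.adjoint_inner_right,
      inner_self_eq_ofReal_norm_sq, ← Complex.ofReal_one, ← Complex.ofReal_sub, Complex.add_re,
      Complex.re_ofReal_mul, Complex.re_ofReal_mul] at h
    have h' : ‖π a Ω‖ ^ 2 = l * (ω₁ (star a * a)).re + (1 - l) * (ω₂ (star a * a)).re := by
      rw [← h]; norm_cast
    have hpos := mul_nonneg (sub_nonneg.2 hl1.le) (Complex.nonneg_iff.1 (h₂.2.2.1 a)).1
    rw [inv_mul_eq_div, le_div_iff₀ hl0]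
    linarith
  obtain ⟨c, hc⟩ := h₁.exists_eq_smul_of_dominated π Ω hcyclic hirr l⁻¹ (by positivity) hdom
  have hc1 : c = 1 := by
    have h := hc 1
    rw [hvec, h₁.2.2.2, hω.2.2.2, mul_one] at h
    exact h.symm
  funext a
  have ha := hc a
  rw [hvec, hc1, one_mul] at ha
  have hl : (1 - (l : ℂ)) ≠ 0 := by
    rw [sub_ne_zero]; exact_mod_cast hl1.ne'
  refine mul_left_cancel₀ hl ?_
  linear_combination hsum a + ha

end Representation

/-- Given a cyclic representation `(H, π, Ω)` of a unital C*-algebra `A` for a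
state `ω`, the state `ω` is pure if and only if the representation `π` is
irreducible, i.e. the only closed `π`-invariant subspaces of `H` are `{0}`
and `H`. -/
theorem pure_iff_irreducible {A : Type*} [NormedRing A] [StarRing A] [CStarRing A]
    [NormedAlgebra ℂ A] [StarModule ℂ A] [CompleteSpace A]
    {H : Type*} [NormedAddCommGroup H] [InnerProductSpace ℂ H] [CompleteSpace H]
    (ω : A → ℂ) (hω : IsState ω)
    (π : A → (H →L[ℂ] H))
    (hmul : ∀ a b : A, π (a * b) = π a * π b)
    (hadd : ∀ a b : A, π (a + b) = π a + π b)
    (hsmul : ∀ (c : ℂ) (a : A), π (c • a) = c • π a)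
    (hstar : ∀ a : A, π (star a) = star (π a))
    (hone : π 1 = 1)
    (Ω : H) (hcyclic : DenseRange fun a : A => π a Ω)
    (hvec : ∀ a : A, ⟪Ω, π a Ω⟫ = ω a) :
    IsPureState ω ↔
      ∀ U : Submodule ℂ H, IsClosed (U : Set H) →
        (∀ a : A, ∀ x ∈ U, π a x ∈ U) → U = ⊥ ∨ U = ⊤ := by
  let ρ : A →⋆ₐ[ℂ] (H →L[ℂ] H) :=
    { toFun := π
      map_one' := hone
      map_mul' := hmul
      map_zero' := by simpa using hsmul 0 0
      map_add' := hadd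
      commutes' := fun c ↦ by simp [Algebra.algebraMap_eq_smul_one, hsmul, hone]
      map_star' := hstar }
  exact ⟨fun h ↦ h.eq_bot_or_eq_top ρ Ω hcyclic hvec,
    isPureState_of_irreducible hω ρ Ω hcyclic hvec⟩
end

section
/- (Gelfand–Naimark) Let 𝔄 be a unital C*-algebra. Then there exist a complex Hilbert space H and a unital *-algebra homomorphism π : 𝔄 → B(H) into the bounded operators on H that is isometric (‖π(a)‖ = ‖a‖ for all a ∈ 𝔄), so that 𝔄 is isomorphic, as a C*-algebra, to the closed *-subalgebra π(𝔄) of B(H). -/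
/-- A faithful (isometric) unital *-representation of a unital C*-algebra `A`
on a complex Hilbert space: a unital *-homomorphism `π : A → B(H)` with
`‖π(a)‖ = ‖a‖` for all `a`, so that `A` is isomorphic, as a C*-algebra, to the
closed *-subalgebra `π(A)` of `B(H)`. -/
structure IsometricRep (A : Type u) [NormedRing A] [StarRing A] [CStarRing A]
    [NormedAlgebra ℂ A] [StarModule ℂ A] [CompleteSpace A] where
  H : Type u
  [instNormedAddCommGroup : NormedAddCommGroup H]
  [instInnerProductSpace : InnerProductSpace ℂ H]
  [instCompleteSpace : CompleteSpace H]
  π : A → (H →L[ℂ] H)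
  map_mul : ∀ a b : A, π (a * b) = π a * π b
  map_add : ∀ a b : A, π (a + b) = π a + π b
  map_smul : ∀ (c : ℂ) (a : A), π (c • a) = c • π a
  map_star : ∀ a : A, π (star a) = star (π a)
  map_one : π 1 = 1
  isometric : ∀ a : A, ‖π a‖ = ‖a‖

section GelfandNaimark

open scoped ComplexOrder ComplexStarModule

/-- The Hilbert direct sum of a family of unital `*`-representations of a C⋆-algebra. -/
noncomputable def StarAlgHom.hilbertSum {A ι : Type*} [CStarAlgebra A] {E : ι → Type*}
    [∀ i, NormedAddCommGroup (E i)] [∀ i, InnerProductSpace ℂ (E i)] [∀ i, CompleteSpace (E i)]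
    (ρ : ∀ i, A →⋆ₐ[ℂ] (E i →L[ℂ] E i)) : A →⋆ₐ[ℂ] (lp E 2 →L[ℂ] lp E 2) where
  toFun a := lp.mapCLM 2 (fun i ↦ ρ i a) (norm_nonneg a)
    fun i ↦ NonUnitalStarAlgHom.norm_apply_le (ρ i) a
  map_one' := by ext; simp
  map_mul' a b := by ext; simp
  map_zero' := by ext; simp
  map_add' a b := by ext; simp
  commutes' c := by ext; simp [Algebra.algebraMap_eq_smul_one]
  map_star' a := by
    rw [ContinuousLinearMap.star_eq_adjoint, ContinuousLinearMap.eq_adjoint_iff]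
    intro x y
    simp only [lp.inner_eq_tsum, lp.mapCLM_apply_coe, map_star,
      ContinuousLinearMap.star_eq_adjoint, ContinuousLinearMap.adjoint_inner_left]

lemma StarAlgHom.hilbertSum_apply_apply {A ι : Type*} [CStarAlgebra A] {E : ι → Type*}
    [∀ i, NormedAddCommGroup (E i)] [∀ i, InnerProductSpace ℂ (E i)] [∀ i, CompleteSpace (E i)]
    (ρ : ∀ i, A →⋆ₐ[ℂ] (E i →L[ℂ] E i)) (a : A) (x : lp E 2) (i : ι) :
    StarAlgHom.hilbertSum ρ a x i = ρ i a (x i) := rfl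

/-- The Hilbert sum of a family of representations that separates points is injective. -/
lemma StarAlgHom.hilbertSum_injective {A ι : Type*} [CStarAlgebra A] {E : ι → Type*}
    [∀ i, NormedAddCommGroup (E i)] [∀ i, InnerProductSpace ℂ (E i)] [∀ i, CompleteSpace (E i)]
    (ρ : ∀ i, A →⋆ₐ[ℂ] (E i →L[ℂ] E i)) (h : ∀ a, (∀ i, ρ i a = 0) → a = 0) :
    Function.Injective (StarAlgHom.hilbertSum ρ) := by
  classical
  rw [injective_iff_map_eq_zero]
  intro a ha
  refine h a fun i ↦ ContinuousLinearMap.ext fun v ↦ ?_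
  simpa [ha] using (StarAlgHom.hilbertSum_apply_apply ρ a (lp.single 2 i v) i).symm

section Positive

variable {A : Type*} [CStarAlgebra A] [PartialOrder A] [StarOrderedRing A]

/-- A nonzero positive element of a C⋆-algebra is detected by a positive functional. -/
lemma PositiveLinearMap.exists_apply_ne_zero {b : A} (hb : 0 ≤ b) (hb₀ : b ≠ 0) :
    ∃ f : A →ₚ[ℂ] ℂ, f b ≠ 0 := by
  have hmem : -b ∉ ProperCone.positive ℝ A := fun h ↦
    hb₀ (le_antisymm (neg_nonneg.mp (ProperCone.mem_positive.mp h)) hb)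
  obtain ⟨g, hg, hgb⟩ := (ProperCone.positive ℝ A).hyperplane_separation_point hmem
  let r : Module.Dual ℝ A :=
    g.toLinearMap ∘ₗ (selfAdjoint.submodule ℝ A).subtype ∘ₗ realPart
  have hr {x : A} (hx : 0 ≤ x) : (r.extendRCLike x : ℂ) = g x := by
    have hx' : IsSelfAdjoint x := .of_nonneg hx
    have hre : r x = g x := congrArg g hx'.coe_realPart
    have him : r (Complex.I • x) = 0 := by
      change g (ℜ (Complex.I • x) : A) = 0
      simp [realPart_I_smul, hx'.imaginaryPart]
    simp [Module.Dual.extendRCLike_apply, hre, him]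
  refine ⟨.mk₀ r.extendRCLike fun x hx ↦ ?_, ?_⟩
  · rw [hr hx]
    exact_mod_cast hg x hx
  · change (r.extendRCLike b : ℂ) ≠ 0
    rw [hr hb]
    have : g b ≠ 0 := by
      intro h
      simp [h] at hgb
    exact_mod_cast this

lemma PositiveLinearMap.apply_star_mul_self_eq_zero_of_gnsStarAlgHom_eq_zero (f : A →ₚ[ℂ] ℂ)
    {a : A} (ha : f.gnsStarAlgHom a = 0) : f (star a * a) = 0 := by
  have h : f.gnsNonUnitalStarAlgHom a (f.toPreGNS 1) = 0 := by
    simpa using DFunLike.congr_fun ha (f.toPreGNS 1 : f.GNS)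
  rw [f.gnsNonUnitalStarAlgHom_apply_coe, ← norm_eq_zero, UniformSpace.Completion.norm_coe] at h
  have hn := f.preGNS_norm_sq (f.leftMulMapPreGNS a (f.toPreGNS 1))
  rw [h] at hn
  simpa using hn.symm

/-- The universal representation of a C⋆-algebra is injective. -/
lemma PositiveLinearMap.hilbertSum_gnsStarAlgHom_injective :
    Function.Injective (StarAlgHom.hilbertSum fun f : A →ₚ[ℂ] ℂ ↦ f.gnsStarAlgHom) := by
  refine StarAlgHom.hilbertSum_injective _ fun a ha ↦ ?_
  by_contra ha₀
  obtain ⟨f, hf⟩ := PositiveLinearMap.exists_apply_ne_zero (star_mul_self_nonneg a)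
    ((CStarRing.star_mul_self_ne_zero_iff a).mpr ha₀)
  exact hf (f.apply_star_mul_self_eq_zero_of_gnsStarAlgHom_eq_zero (ha f))

end Positive

/-- Every unital C⋆-algebra has an isometric unital `*`-representation on a Hilbert space. -/
lemma CStarAlgebra.exists_isometric_starAlgHom.{v} (A : Type v) [CStarAlgebra A] :
    ∃ (H : Type v) (_ : NormedAddCommGroup H) (_ : InnerProductSpace ℂ H) (_ : CompleteSpace H)
      (φ : A →⋆ₐ[ℂ] (H →L[ℂ] H)), ∀ a, ‖φ a‖ = ‖a‖ :=
  let _ := CStarAlgebra.spectralOrder A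
  let _ := CStarAlgebra.spectralOrderedRing A
  ⟨↥(lp (fun f : A →ₚ[ℂ] ℂ ↦ f.GNS) 2), inferInstance, inferInstance, inferInstance,
    StarAlgHom.hilbertSum fun f : A →ₚ[ℂ] ℂ ↦ f.gnsStarAlgHom,
    NonUnitalStarAlgHom.norm_map _ PositiveLinearMap.hilbertSum_gnsStarAlgHom_injective⟩

end GelfandNaimark

/-- Gelfand–Naimark theorem: every unital C*-algebra admits an isometric
unital *-representation on some complex Hilbert space, hence is isomorphic as
a C*-algebra to a closed *-subalgebra of some `B(H)`. -/
theorem gelfand_naimark (A : Type u) [NormedRing A] [StarRing A] [CStarRing A]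
    [NormedAlgebra ℂ A] [StarModule ℂ A] [CompleteSpace A] :
    Nonempty (IsometricRep A) := by
  let _ : CStarAlgebra A := {}
  obtain ⟨H, _, _, _, φ, hφ⟩ := CStarAlgebra.exists_isometric_starAlgHom A
  exact ⟨{
    H := H
    π := φ
    map_mul := map_mul φ
    map_add := map_add φ
    map_smul := map_smul φ
    map_star := map_star φ
    map_one := map_one φ
    isometric := hφ }⟩
end
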